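/- Let r be a nonnegative integer, M a definable C^r submanifold of ℝⁿ that is closed in ℝⁿ, and ψ: M → ℝ a positive definable function that is locally bounded from below by positive constants (every point of M has a neighborhood in M on which ψ is bounded below by some positive constant). Then there exists a definable C^r function ε: M → ℝ with 0 < ε(x) < ψ(x) for all x ∈ M. -/

import Mathlib

open FirstOrder Set Topology

namespace Paper

variable (L : FirstOrder.Language) [L.Structure ℝ]

/-- A subset of `ℝⁿ` is definable in the structure (with parameters from `ℝ`). -/
def Def (n : ℕ) (s : Set (Fin n → ℝ)) : Prop :=
  Set.Definable (Set.univ : Set ℝ) L s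

/-- A subset of `ℝ` is definable. -/
def Def1 (s : Set ℝ) : Prop := Def L 1 {x | x 0 ∈ s}

/-- The structure expands the ordered field `(ℝ, <, +, ·, 0, 1)`:
the order and the field operations (and the constants) are definable. -/
def ExpandsOrderedField : Prop :=
  Def L 2 {x | x 0 < x 1} ∧ Def L 3 {x | x 0 + x 1 = x 2} ∧
  Def L 3 {x | x 0 * x 1 = x 2} ∧ Def L 1 {x | x 0 = 0} ∧ Def L 1 {x | x 0 = 1}

/-- Local o-minimality: every definable subset of `ℝ` is, near each point, a finite
union of points and open intervals. -/
def LocallyOMinimal : Prop :=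
  ∀ X : Set ℝ, Def1 L X → ∀ a : ℝ,
    ∃ b c : ℝ, b < a ∧ a < c ∧
      ∃ (P : Finset ℝ) (J : Finset (ℝ × ℝ)),
        X ∩ Set.Ioo b c = ↑P ∪ ⋃ p ∈ J, Set.Ioo p.1 p.2

/-- First component of a point of `ℝ^(m+n) = ℝ^m × ℝ^n`. -/
def fstFun {m n : ℕ} (z : Fin (m + n) → ℝ) : Fin m → ℝ := fun i => z (Fin.castAdd n i)

/-- Second component of a point of `ℝ^(m+n) = ℝ^m × ℝ^n`. -/
def sndFun {m n : ℕ} (z : Fin (m + n) → ℝ) : Fin n → ℝ := fun j => z (Fin.natAdd m j)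

/-- The map `f : X → ℝⁿ`, `X ⊆ ℝ^m`, is definable (its graph over `X` is definable). -/
def DefMapOn (m n : ℕ) (X : Set (Fin m → ℝ)) (f : (Fin m → ℝ) → (Fin n → ℝ)) : Prop :=
  Def L (m + n) {z | fstFun z ∈ X ∧ sndFun z = f (fstFun z)}

/-- The function `f : X → ℝ`, `X ⊆ ℝ^m`, is definable. -/
def DefFunOn (m : ℕ) (X : Set (Fin m → ℝ)) (f : (Fin m → ℝ) → ℝ) : Prop :=
  DefMapOn L m 1 X fun x _ => f x

/-- `f` is of class `C^r` on `X` in the sense that near every point of `X` it agrees on `X`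
with a `C^r` map defined on an open neighborhood in the ambient space. -/
def CrMapOn (r m n : ℕ) (X : Set (Fin m → ℝ)) (f : (Fin m → ℝ) → (Fin n → ℝ)) : Prop :=
  ∀ a ∈ X, ∃ (W : Set (Fin m → ℝ)) (g : (Fin m → ℝ) → (Fin n → ℝ)),
    a ∈ W ∧ IsOpen W ∧ ContDiffOn ℝ r g W ∧ Set.EqOn f g (X ∩ W)

/-- Real-valued version of `CrMapOn`. -/
def CrFunOn (r m : ℕ) (X : Set (Fin m → ℝ)) (f : (Fin m → ℝ) → ℝ) : Prop :=
  ∀ a ∈ X, ∃ (W : Set (Fin m → ℝ)) (g : (Fin m → ℝ) → ℝ),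
    a ∈ W ∧ IsOpen W ∧ ContDiffOn ℝ r g W ∧ Set.EqOn f g (X ∩ W)

/-- A definable `C^r` map `X → ℝⁿ`. -/
def DefCrMapOn (r m n : ℕ) (X : Set (Fin m → ℝ)) (f : (Fin m → ℝ) → (Fin n → ℝ)) : Prop :=
  DefMapOn L m n X f ∧ CrMapOn r m n X f

/-- A definable `C^r` function `X → ℝ`. -/
def DefCrFunOn (r m : ℕ) (X : Set (Fin m → ℝ)) (f : (Fin m → ℝ) → ℝ) : Prop :=
  DefFunOn L m X f ∧ CrFunOn r m X f

/-- A definable `C^r` submanifold of `ℝⁿ` of dimension `d`: around every point there is a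
definable `C^r` chart of `ℝⁿ` straightening `M` to the first `d` coordinates. -/
def IsDefCrSubmanifold (r n d : ℕ) (M : Set (Fin n → ℝ)) : Prop :=
  Def L n M ∧
  ∀ a ∈ M, ∃ (U V : Set (Fin n → ℝ)) (φ ψ : (Fin n → ℝ) → (Fin n → ℝ)),
    a ∈ U ∧ IsOpen U ∧ Def L n U ∧
    (0 : Fin n → ℝ) ∈ V ∧ IsOpen V ∧ Def L n V ∧
    DefMapOn L n n U φ ∧ DefMapOn L n n V ψ ∧
    ContDiffOn ℝ r φ U ∧ ContDiffOn ℝ r ψ V ∧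
    Set.BijOn φ U V ∧ Set.InvOn ψ φ U V ∧
    φ a = 0 ∧
    φ '' (M ∩ U) = {x ∈ V | ∀ i : Fin n, d ≤ (i : ℕ) → x i = 0}

/-- The Euclidean norm on `ℝⁿ`. -/
noncomputable def eunorm {n : ℕ} (x : Fin n → ℝ) : ℝ := Real.sqrt (∑ i, x i ^ 2)

/-- Projection of `ℝⁿ` onto the `d` coordinates selected by `σ`. -/
def coordProj {n : ℕ} (d : ℕ) (σ : Fin d → Fin n) (x : Fin n → ℝ) : Fin d → ℝ :=
  fun i => x (σ i)

/-- `X ⊆ ℝⁿ` has dimension `d`: `d` is the largest integer such that some coordinate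
projection of `X` onto `ℝ^d` has nonempty interior. -/
def HasDim {n : ℕ} (X : Set (Fin n → ℝ)) (d : ℕ) : Prop :=
  (∃ σ : Fin d → Fin n, Function.Injective σ ∧ (interior (coordProj d σ '' X)).Nonempty) ∧
  ∀ (e : ℕ) (σ : Fin e → Fin n), Function.Injective σ →
    (interior (coordProj e σ '' X)).Nonempty → e ≤ d

/-- A (bounded) open box in `ℝⁿ`. -/
def IsOpenBox {n : ℕ} (B : Set (Fin n → ℝ)) : Prop :=
  ∃ a b : Fin n → ℝ, (∀ i, a i < b i) ∧ B = Set.pi Set.univ fun i => Set.Ioo (a i) (b i)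


section Definability

/-- The predicate `P` on `ℝ^α` is definable with real parameters. -/
def DPred {α : Type} (P : (α → ℝ) → Prop) : Prop :=
  (univ : Set ℝ).Definable L {x | P x}

/-- The function `f` on `ℝ^α` is definable with real parameters. -/
def DFun {α : Type} (f : (α → ℝ) → ℝ) : Prop :=
  (univ : Set ℝ).DefinableFun L f

variable {L}
variable {α β : Type} {P Q : (α → ℝ) → Prop} {f g : (α → ℝ) → ℝ}

theorem DPred.and (hP : DPred L P) (hQ : DPred L Q) : DPred L fun x => P x ∧ Q x :=
  Definable.inter hP hQ

theorem DPred.or (hP : DPred L P) (hQ : DPred L Q) : DPred L fun x => P x ∨ Q x :=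
  Definable.union hP hQ

theorem DPred.not (hP : DPred L P) : DPred L fun x => ¬ P x :=
  Definable.compl hP

theorem DPred.congr (hP : DPred L P) (h : ∀ x, Q x ↔ P x) : DPred L Q := by
  have : Q = P := funext fun x => propext (h x)
  rwa [this]

theorem DPred.imp (hP : DPred L P) (hQ : DPred L Q) : DPred L fun x => P x → Q x :=
  (hP.not.or hQ).congr fun _ => imp_iff_not_or

theorem DPred.exists_fun [Finite β] {R : (α → ℝ) → (β → ℝ) → Prop}
    (h : DPred L fun z : α ⊕ β → ℝ => R (fun i => z (Sum.inl i)) (fun j => z (Sum.inr j))) :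
    DPred L fun x => ∃ y, R x y :=
  Definable.exists_of_finite h

theorem DPred.exists {R : (α → ℝ) → ℝ → Prop}
    (h : DPred L fun z : α ⊕ Unit → ℝ => R (fun i => z (Sum.inl i)) (z (Sum.inr ()))) :
    DPred L fun x => ∃ y, R x y := by
  refine DPred.congr (DPred.exists_fun (β := Unit) (R := fun x y => R x (y ())) h) fun x => ?_
  exact ⟨fun ⟨y, hy⟩ => ⟨fun _ => y, hy⟩, fun ⟨y, hy⟩ => ⟨y (), hy⟩⟩

theorem DPred.forall {R : (α → ℝ) → ℝ → Prop}
    (h : DPred L fun z : α ⊕ Unit → ℝ => R (fun i => z (Sum.inl i)) (z (Sum.inr ()))) :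
    DPred L fun x => ∀ y, R x y :=
  (DPred.exists (R := fun x y => ¬ R x y) h.not).not.congr fun x => by simp

theorem DFun.var (i : α) : DFun L fun x => x i :=
  DefinableFun.proj L

theorem DFun.const (c : ℝ) : DFun L fun _ : α → ℝ => c :=
  FirstOrder.Language.definableFun_const L α (mem_univ c)

theorem DPred.subst [Finite β] {R : (β → ℝ) → Prop} (hR : DPred L R)
    {F : β → (α → ℝ) → ℝ} (hF : ∀ b, DFun L (F b)) : DPred L fun x => R fun b => F b x :=
  Definable.preimage_map (F := fun x b => F b x) hF hR

theorem DFun.subst [Finite β] {f : (β → ℝ) → ℝ} (hf : DFun L f)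
    {F : β → (α → ℝ) → ℝ} (hF : ∀ b, DFun L (F b)) : DFun L fun x => f fun b => F b x :=
  DefinableFun.comp (g := fun x b => F b x) hF hf

theorem DPred.eq (hf : DFun L f) (hg : DFun L g) : DPred L fun x => f x = g x :=
  DefinableFun.ofPred_eq hf hg

theorem DFun.of_graph (h : DPred L fun z : Option α → ℝ => z none = f fun i => z (some i)) :
    DFun L f := by
  refine DPred.congr h fun z => ?_
  exact eq_comm

/-- A unary function is definable as soon as its graph is described by a definable relation. -/
theorem DFun.of_graph_iff {f : ℝ → ℝ} {R : ℝ → ℝ → Prop} (hR : ∀ t y, y = f t ↔ R t y)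
    (h : DPred L fun z : Fin 2 → ℝ => R (z 0) (z 1)) : DFun L fun x : Unit → ℝ => f (x ()) := by
  refine DFun.of_graph ?_
  have := h.subst (F := ![fun z : Option Unit → ℝ => z (some ()), fun z => z none])
    (by intro b; fin_cases b <;> exact DFun.var _)
  exact this.congr fun z => hR _ _

theorem DFun.comp_unary {F : ℝ → ℝ} (hF : DFun L fun x : Unit → ℝ => F (x ()))
    (hf : DFun L f) : DFun L fun x => F (f x) :=
  hF.subst (F := fun _ => f) fun _ => hf

theorem DPred.comp_unary {X : ℝ → Prop} (hX : DPred L fun x : Unit → ℝ => X (x ()))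
    (hf : DFun L f) : DPred L fun x => X (f x) :=
  hX.subst (F := fun _ => f) fun _ => hf

theorem DPred.comp_binary {R : ℝ → ℝ → Prop} (hR : DPred L fun x : Fin 2 → ℝ => R (x 0) (x 1))
    (hf : DFun L f) (hg : DFun L g) : DPred L fun x => R (f x) (g x) :=
  hR.subst (F := ![f, g]) (by intro b; fin_cases b <;> assumption)

theorem DPred.comp_ternary {R : ℝ → ℝ → ℝ → Prop}
    (hR : DPred L fun x : Fin 3 → ℝ => R (x 0) (x 1) (x 2)) {h : (α → ℝ) → ℝ}
    (hf : DFun L f) (hg : DFun L g) (hh : DFun L h) : DPred L fun x => R (f x) (g x) (h x) :=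
  hR.subst (F := ![f, g, h]) (by intro b; fin_cases b <;> assumption)

theorem DPred.lt (hE : ExpandsOrderedField L) (hf : DFun L f) (hg : DFun L g) :
    DPred L fun x => f x < g x :=
  DPred.comp_binary (R := fun a b => a < b) hE.1 hf hg

theorem DPred.le (hE : ExpandsOrderedField L) (hf : DFun L f) (hg : DFun L g) :
    DPred L fun x => f x ≤ g x :=
  (DPred.lt hE hg hf).not.congr fun _ => not_lt.symm

section Finite

variable [Finite α]

theorem DFun.of_ternary {op : ℝ → ℝ → ℝ}
    (hop : DPred L fun x : Fin 3 → ℝ => op (x 0) (x 1) = x 2)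
    (hf : DFun L f) (hg : DFun L g) : DFun L fun x => op (f x) (g x) := by
  refine DFun.of_graph ?_
  refine (DPred.comp_ternary (R := fun a b c => op a b = c) hop
    (f := fun z : Option α → ℝ => f fun i => z (some i))
    (g := fun z => g fun i => z (some i)) (h := fun z => z none) ?_ ?_ ?_).congr fun z => eq_comm
  · exact hf.subst (F := fun i z => z (some i)) fun _ => DFun.var _
  · exact hg.subst (F := fun i z => z (some i)) fun _ => DFun.var _
  · exact DFun.var _

theorem DFun.add (hE : ExpandsOrderedField L) (hf : DFun L f) (hg : DFun L g) :
    DFun L fun x => f x + g x :=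
  DFun.of_ternary (op := fun a b => a + b) hE.2.1 hf hg

theorem DFun.mul (hE : ExpandsOrderedField L) (hf : DFun L f) (hg : DFun L g) :
    DFun L fun x => f x * g x :=
  DFun.of_ternary (op := fun a b => a * b) hE.2.2.1 hf hg

theorem DFun.neg (hE : ExpandsOrderedField L) (hf : DFun L f) : DFun L fun x => -f x := by
  simpa using DFun.mul hE (DFun.const (-1)) hf

theorem DFun.sub (hE : ExpandsOrderedField L) (hf : DFun L f) (hg : DFun L g) :
    DFun L fun x => f x - g x := by
  simpa [sub_eq_add_neg] using hf.add hE (hg.neg hE)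

theorem DFun.pow (hE : ExpandsOrderedField L) (hf : DFun L f) (k : ℕ) :
    DFun L fun x => f x ^ k := by
  induction k with
  | zero => simpa using DFun.const (L := L) 1
  | succ k ih => simpa [pow_succ] using ih.mul hE hf

theorem DFun.sum (hE : ExpandsOrderedField L) {ι : Type} (s : Finset ι) {F : ι → (α → ℝ) → ℝ}
    (hF : ∀ i, DFun L (F i)) : DFun L fun x => ∑ i ∈ s, F i x := by
  classical
  induction s using Finset.induction_on with
  | empty => simpa using DFun.const (L := L) 0
  | insert i s hi ih => simpa [Finset.sum_insert hi] using (hF i).add hE ih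

end Finite

theorem DFun.inv (hE : ExpandsOrderedField L) (hf : DFun L f) : DFun L fun x => (f x)⁻¹ := by
  refine DFun.comp_unary (F := fun t => t⁻¹) ?_ hf
  refine DFun.of_graph_iff (R := fun t y => t * y = 1 ∨ (t = 0 ∧ y = 0)) (fun t y => ?_) ?_
  · rcases eq_or_ne t 0 with rfl | h
    · simp
    · simp only [h, false_and, or_false]
      exact ⟨fun hy => by rw [hy]; exact mul_inv_cancel₀ h, fun hy => eq_inv_of_mul_eq_one_right hy⟩
  · exact (DPred.eq (.mul hE (.var _) (.var _)) (.const _)).or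
      ((DPred.eq (.var _) (.const _)).and (DPred.eq (.var _) (.const _)))

theorem DFun.max [Finite α] (hE : ExpandsOrderedField L) (hf : DFun L f) (hg : DFun L g) :
    DFun L fun x => max (f x) (g x) := by
  refine DFun.of_ternary (op := fun a b => Max.max a b) ?_ hf hg
  refine (((DPred.le hE (.var 0) (.var 1)).and (.eq (.var 1) (.var 2))).or
    ((DPred.le hE (.var 1) (.var 0)).and (.eq (.var 0) (.var 2)))).congr fun x => ?_
  rcases le_total (x 0) (x 1) with h | h
  · simp only [max_eq_right h]; grind
  · simp only [max_eq_left h]; grind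

theorem DFun.abs [Finite α] (hE : ExpandsOrderedField L) (hf : DFun L f) : DFun L fun x => |f x| :=
  hf.max hE (hf.neg hE)

theorem dpred_unary_iff_def1 {X : Set ℝ} : DPred L (fun x : Unit → ℝ => x () ∈ X) ↔ Def1 L X :=
  ⟨fun h => h.subst (F := fun _ (x : Fin 1 → ℝ) => x 0) fun _ => .var _,
    fun h => DPred.subst (R := fun x : Fin 1 → ℝ => x 0 ∈ X) h
      (F := fun _ (x : Unit → ℝ) => x ()) fun _ => .var _⟩

end Definability

section LocalBehaviour

open Filter

variable {L}

/-- `X` or its complement belongs to the filter `l`. -/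
def Decides (l : Filter ℝ) (X : Set ℝ) : Prop := (∀ᶠ x in l, x ∈ X) ∨ ∀ᶠ x in l, x ∉ X

theorem Decides.union {l : Filter ℝ} {X Y : Set ℝ} (hX : Decides l X) (hY : Decides l Y) :
    Decides l (X ∪ Y) := by
  rcases hX with hX | hX
  · exact .inl (hX.mono fun x hx => .inl hx)
  · rcases hY with hY | hY
    · exact .inl (hY.mono fun x hx => .inr hx)
    · refine .inr ?_
      filter_upwards [hX, hY] with x hx hy h
      exact h.elim hx hy

theorem Decides.biUnion {ι : Type*} {l : Filter ℝ} (J : Finset ι) {X : ι → Set ℝ}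
    (hX : ∀ i, Decides l (X i)) : Decides l (⋃ i ∈ J, X i) := by
  classical
  induction J using Finset.induction_on with
  | empty => exact .inr (by simp)
  | insert i J hi ih => rw [Finset.set_biUnion_insert]; exact (hX i).union ih

theorem LocallyOMinimal.decides (hlom : LocallyOMinimal L) {X : Set ℝ} (hX : Def1 L X) {a : ℝ}
    {l : Filter ℝ} (hl : l ≤ 𝓝[≠] a) (hIoo : ∀ p q, Decides l (Ioo p q)) : Decides l X := by
  obtain ⟨b, c, hb, hc, P, J, hPJ⟩ := hlom X hX a
  have hbc : ∀ᶠ x in l, x ∈ Ioo b c :=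
    hl (mem_nhdsWithin_of_mem_nhds (Ioo_mem_nhds hb hc))
  have hP : Decides l (P : Set ℝ) := by
    have := Decides.biUnion (l := l) P (X := fun p => {p}) fun p => by
      right
      rcases eq_or_ne p a with rfl | h
      · exact hl (by filter_upwards [self_mem_nhdsWithin] with x hx using hx)
      · exact hl (mem_nhdsWithin_of_mem_nhds
          (by filter_upwards [isOpen_ne.mem_nhds h.symm] with x hx using hx))
    rwa [show (⋃ i ∈ P, {i}) = (P : Set ℝ) by ext; simp] at this
  have := hP.union (Decides.biUnion J (X := fun p : ℝ × ℝ => Ioo p.1 p.2) fun p => hIoo _ _)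
  rw [← hPJ] at this
  rcases this with h | h
  · exact .inl (h.mono fun x hx => hx.1)
  · refine .inr ?_
    filter_upwards [h, hbc] with x hx hx' hX using hx ⟨hX, hx'⟩

theorem LocallyOMinimal.decides_right (hlom : LocallyOMinimal L) {X : Set ℝ} (hX : Def1 L X)
    (a : ℝ) : Decides (𝓝[>] a) X := by
  refine hlom.decides hX (nhdsWithin_mono a fun x hx => ne_of_gt hx) fun p q => ?_
  rcases lt_or_ge a p with hp | hp
  · right
    filter_upwards [Ioo_mem_nhdsGT hp] with x hx h using lt_asymm hx.2 h.1
  rcases lt_or_ge a q with hq | hq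
  · left
    filter_upwards [Ioo_mem_nhdsGT hq] with x hx using ⟨hp.trans_lt hx.1, hx.2⟩
  · right
    filter_upwards [self_mem_nhdsWithin] with x hx h using lt_asymm (hq.trans_lt hx) h.2

theorem LocallyOMinimal.decides_left (hlom : LocallyOMinimal L) {X : Set ℝ} (hX : Def1 L X)
    (a : ℝ) : Decides (𝓝[<] a) X := by
  refine hlom.decides hX (nhdsWithin_mono a fun x hx => ne_of_lt hx) fun p q => ?_
  rcases lt_or_ge q a with hq | hq
  · right
    filter_upwards [Ioo_mem_nhdsLT hq] with x hx h using lt_asymm hx.1 h.2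
  rcases lt_or_ge p a with hp | hp
  · left
    filter_upwards [Ioo_mem_nhdsLT hp] with x hx using ⟨hx.1, hx.2.trans_le hq⟩
  · right
    filter_upwards [self_mem_nhdsWithin] with x hx h using
      lt_asymm (lt_of_lt_of_le (Set.mem_Iio.1 hx) hp) h.1

end LocalBehaviour

section Monotonicity

open Filter

/-- A function whose value at every point of a half-line is locally bounded below on the right
and locally bounded above on the left is monotone there. -/
theorem monotoneOn_Ioi_of_local {f : ℝ → ℝ} {T : ℝ}
    (hr : ∀ x > T, ∀ᶠ y in 𝓝[>] x, f x ≤ f y) (hl : ∀ x > T, ∀ᶠ y in 𝓝[<] x, f y ≤ f x) :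
    MonotoneOn f (Ioi T) := by
  intro a ha b _ hab
  by_contra hlt
  set S := {c | a ≤ c ∧ c ≤ b ∧ ∀ u ∈ Icc a c, f a ≤ f u}
  have haS : a ∈ S := ⟨le_rfl, hab, fun u hu => by rw [le_antisymm hu.2 hu.1]⟩
  have hbdd : BddAbove S := ⟨b, fun c hc => hc.2.1⟩
  set c := sSup S with hc
  have hac : a ≤ c := le_csSup hbdd haS
  have hcb : c ≤ b := csSup_le ⟨a, haS⟩ fun c hc => hc.2.1
  have hbelow : ∀ u, a ≤ u → u < c → f a ≤ f u := fun u hau huc => by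
    obtain ⟨v, hv, huv⟩ := exists_lt_of_lt_csSup ⟨a, haS⟩ huc
    exact hv.2.2 u ⟨hau, huv.le⟩
  have hfc : f a ≤ f c := by
    rcases hac.eq_or_lt with h | h
    · rw [← h]
    · obtain ⟨u, hu, hu'⟩ := ((hl c (lt_of_lt_of_le ha hac)).and (Ioo_mem_nhdsLT h)).exists
      exact (hbelow u hu'.1.le hu'.2).trans hu
  have hcb' : c < b := hcb.lt_of_ne fun h => hlt (h ▸ hfc)
  obtain ⟨d, hd, hd'⟩ := (mem_nhdsGT_iff_exists_Ioo_subset' hcb').1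
    (hr c (lt_of_lt_of_le ha hac))
  have hcd : c < (c + min d b) / 2 := by
    have : c < min d b := lt_min hd hcb'
    linarith
  have hdd : (c + min d b) / 2 < min d b := by
    have : c < min d b := lt_min hd hcb'
    linarith
  have : (c + min d b) / 2 ∈ S := by
    refine ⟨hac.trans hcd.le, hdd.le.trans (min_le_right _ _), fun u hu => ?_⟩
    rcases lt_trichotomy u c with h | h | h
    · exact hbelow u hu.1 h
    · rwa [h]
    · exact hfc.trans (hd' ⟨h, lt_of_le_of_lt hu.2 (hdd.trans_le (min_le_left _ _))⟩)
  exact absurd (le_csSup hbdd this) (not_le.2 hcd)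

/-- The points of a half-line cannot all be local minima which are strict on the left. -/
theorem false_of_forall_localMin {f : ℝ → ℝ} {T : ℝ}
    (hr : ∀ x > T, ∀ᶠ y in 𝓝[>] x, f x ≤ f y) (hl : ∀ x > T, ∀ᶠ y in 𝓝[<] x, f x < f y) :
    False := by
  have key : ∀ x : Ioi T, ∃ pq : ℚ × ℚ, (pq.1 : ℝ) < x ∧ (x : ℝ) < pq.2 ∧
      (∀ y, (x : ℝ) < y → y < pq.2 → f x ≤ f y) ∧ ∀ y, (pq.1 : ℝ) < y → y < x → f x < f y := by
    rintro ⟨x, hx⟩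
    obtain ⟨d, hd, hd'⟩ := (mem_nhdsGT_iff_exists_Ioo_subset).1 (hr x hx)
    obtain ⟨e, he, he'⟩ := (mem_nhdsLT_iff_exists_Ioo_subset).1 (hl x hx)
    obtain ⟨p, hp, hp'⟩ := exists_rat_btwn (Set.mem_Iio.1 he)
    obtain ⟨q, hq, hq'⟩ := exists_rat_btwn (Set.mem_Ioi.1 hd)
    exact ⟨(p, q), hp', hq, fun y hy hy' => hd' ⟨hy, hy'.trans hq'⟩,
      fun y hy hy' => he' ⟨hp.trans hy, hy'⟩⟩
  choose F hF1 hF2 hF3 hF4 using key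
  have hlt : ∀ x y : Ioi T, F x = F y → ¬ (x : ℝ) < y := fun x y hxy h => by
    have h1 := hF3 x y h (hxy ▸ hF2 y)
    have h2 := hF4 y x (hxy ▸ hF1 x) h
    exact absurd h1 (not_le.2 h2)
  have hinj : Function.Injective F := fun x y hxy =>
    Subtype.ext (le_antisymm (not_lt.1 (hlt y x hxy.symm)) (not_lt.1 (hlt x y hxy)))
  have hcount : (Ioi T).Countable := (Set.countable_coe_iff).1 hinj.countable
  simpa using hcount.measure_zero MeasureTheory.volume

end Monotonicity

section EventualSmoothness

open Filter

variable {L}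

theorem DPred.eventually_nhdsGT (hE : ExpandsOrderedField L) {Q : ℝ → ℝ → Prop}
    (hQ : DPred L fun x : Fin 2 → ℝ => Q (x 0) (x 1)) :
    DPred L fun x : Unit → ℝ => ∀ᶠ y in 𝓝[>] x (), Q (x ()) y := by
  refine DPred.congr (P := fun x : Unit → ℝ =>
    ∃ d, x () < d ∧ ∀ y, x () < y → y < d → Q (x ()) y) ?_ fun x => ?_
  · exact .exists (.and (.lt hE (.var _) (.var _)) (.forall (.imp (.lt hE (.var _) (.var _))
      (.imp (.lt hE (.var _) (.var _)) (.comp_binary hQ (.var _) (.var _))))))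
  · refine mem_nhdsGT_iff_exists_Ioo_subset.trans ?_
    exact exists_congr fun d => and_congr_right fun _ =>
      ⟨fun h y h1 h2 => h ⟨h1, h2⟩, fun h y hy => h y hy.1 hy.2⟩

theorem DPred.eventually_nhdsLT (hE : ExpandsOrderedField L) {Q : ℝ → ℝ → Prop}
    (hQ : DPred L fun x : Fin 2 → ℝ => Q (x 0) (x 1)) :
    DPred L fun x : Unit → ℝ => ∀ᶠ y in 𝓝[<] x (), Q (x ()) y := by
  refine DPred.congr (P := fun x : Unit → ℝ =>
    ∃ d, d < x () ∧ ∀ y, d < y → y < x () → Q (x ()) y) ?_ fun x => ?_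
  · exact .exists (.and (.lt hE (.var _) (.var _)) (.forall (.imp (.lt hE (.var _) (.var _))
      (.imp (.lt hE (.var _) (.var _)) (.comp_binary hQ (.var _) (.var _))))))
  · refine mem_nhdsLT_iff_exists_Ioo_subset.trans ?_
    exact exists_congr fun d => and_congr_right fun _ =>
      ⟨fun h y h1 h2 => h ⟨h1, h2⟩, fun h y hy => h y hy.1 hy.2⟩

theorem dpred_hasDerivAt (hE : ExpandsOrderedField L) {f : ℝ → ℝ}
    (hf : DFun L fun x : Unit → ℝ => f (x ())) :
    DPred L fun x : Fin 2 → ℝ => HasDerivAt f (x 1) (x 0) := by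
  refine DPred.congr (P := fun x : Fin 2 → ℝ => ∀ c, 0 < c → ∃ δ, 0 < δ ∧ ∀ u, |u - x 0| < δ →
    |f u - f (x 0) - (u - x 0) * x 1| ≤ c * |u - x 0|) ?_ fun x => ?_
  · refine .forall (.imp (.lt hE (.const _) (.var _)) (.exists (.and (.lt hE (.const _) (.var _))
      (.forall (.imp (.lt hE ?_ (.var _)) (.le hE ?_ ?_))))))
    · exact .abs hE (.sub hE (.var _) (.var _))
    · exact .abs hE (.sub hE (.sub hE (.comp_unary hf (.var _)) (.comp_unary hf (.var _)))
        (.mul hE (.sub hE (.var _) (.var _)) (.var _)))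
    · exact .mul hE (.var _) (.abs hE (.sub hE (.var _) (.var _)))
  · rw [hasDerivAt_iff_isLittleO, Asymptotics.isLittleO_iff]
    refine forall_congr' fun c => imp_congr_right fun _ => ?_
    rw [Metric.eventually_nhds_iff]
    simp only [Real.dist_eq, Real.norm_eq_abs, smul_eq_mul, gt_iff_lt]

theorem DFun.deriv (hE : ExpandsOrderedField L) {f : ℝ → ℝ}
    (hf : DFun L fun x : Unit → ℝ => f (x ())) :
    DFun L fun x : Unit → ℝ => deriv f (x ()) := by
  have hder := dpred_hasDerivAt hE hf
  refine DFun.of_graph_iff (R := fun t y => HasDerivAt f y t ∨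
    ((¬ ∃ y', HasDerivAt f y' t) ∧ y = 0)) (fun t y => ?_) ?_
  · by_cases h : DifferentiableAt ℝ f t
    · have h' : ∃ y', HasDerivAt f y' t := ⟨_, h.hasDerivAt⟩
      simp only [h', not_true, false_and, or_false]
      exact ⟨fun hy => hy ▸ h.hasDerivAt, fun hy => hy.deriv.symm⟩
    · have h' : ∀ y', ¬ HasDerivAt f y' t := fun y' hy => h hy.differentiableAt
      simp [h', deriv_zero_of_not_differentiableAt h]
  · refine .or hder (.and (.not (.exists ?_)) (.eq (.var _) (.const _)))
    exact .comp_binary (R := fun t y => HasDerivAt f y t) hder (.var _) (.var _)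

/-- If every definable subset of `ℝ` is eventually constant, then every definable function is
eventually monotone. -/
theorem eventually_monotone (hE : ExpandsOrderedField L) (hlom : LocallyOMinimal L)
    (htame : ∀ X, Def1 L X → Decides atTop X) {f : ℝ → ℝ}
    (hf : DFun L fun x : Unit → ℝ => f (x ())) :
    ∃ T, MonotoneOn f (Ioi T) ∨ MonotoneOn (-f) (Ioi T) := by
  have hle : DPred L fun x : Fin 2 → ℝ => f (x 0) ≤ f (x 1) :=
    .le hE (.comp_unary hf (.var _)) (.comp_unary hf (.var _))
  have hge : DPred L fun x : Fin 2 → ℝ => f (x 1) ≤ f (x 0) :=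
    .le hE (.comp_unary hf (.var _)) (.comp_unary hf (.var _))
  have hlt : DPred L fun x : Fin 2 → ℝ => f (x 1) < f (x 0) :=
    .lt hE (.comp_unary hf (.var _)) (.comp_unary hf (.var _))
  have hA := htame {x | ∀ᶠ y in 𝓝[>] x, f x ≤ f y}
    (dpred_unary_iff_def1.1 (DPred.eventually_nhdsGT hE (Q := fun x y => f x ≤ f y) hle))
  have hB := htame {x | ∀ᶠ y in 𝓝[<] x, f y ≤ f x}
    (dpred_unary_iff_def1.1 (DPred.eventually_nhdsLT hE (Q := fun x y => f y ≤ f x) hge))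
  have hC := htame {x | ∀ᶠ y in 𝓝[<] x, f y < f x}
    (dpred_unary_iff_def1.1 (DPred.eventually_nhdsLT hE (Q := fun x y => f y < f x) hlt))
  have hA' : ∀ x, ¬ (∀ᶠ y in 𝓝[>] x, f x ≤ f y) → ∀ᶠ y in 𝓝[>] x, f y < f x := fun x hx =>
    ((hlom.decides_right (X := {y | f x ≤ f y}) (dpred_unary_iff_def1.1
      (.le hE (.const _) hf)) x).resolve_left hx).mono fun y hy => not_le.1 hy
  have hB' : ∀ x, ¬ (∀ᶠ y in 𝓝[<] x, f y ≤ f x) → ∀ᶠ y in 𝓝[<] x, f x < f y := fun x hx =>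
    ((hlom.decides_left (X := {y | f y ≤ f x}) (dpred_unary_iff_def1.1
      (.le hE hf (.const _))) x).resolve_left hx).mono fun y hy => not_le.1 hy
  have hC' : ∀ x, ¬ (∀ᶠ y in 𝓝[<] x, f y < f x) → ∀ᶠ y in 𝓝[<] x, f x ≤ f y := fun x hx =>
    ((hlom.decides_left (X := {y | f y < f x}) (dpred_unary_iff_def1.1
      (.lt hE hf (.const _))) x).resolve_left hx).mono fun y hy => not_lt.1 hy
  rcases hA with hA | hA
  · rcases hB with hB | hB
    · obtain ⟨T, hT⟩ := eventually_atTop.1 (hA.and hB)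
      exact ⟨T, .inl (monotoneOn_Ioi_of_local (fun x hx => (hT x (le_of_lt hx)).1)
        fun x hx => (hT x (le_of_lt hx)).2)⟩
    · obtain ⟨T, hT⟩ := eventually_atTop.1 (hA.and hB)
      exact (false_of_forall_localMin (T := T) (fun x hx => (hT x (le_of_lt hx)).1)
        fun x hx => hB' x (hT x (le_of_lt hx)).2).elim
  · rcases hC with hC | hC
    · obtain ⟨T, hT⟩ := eventually_atTop.1 (hA.and hC)
      exact (false_of_forall_localMin (f := -f) (T := T)
        (fun x hx => (hA' x (hT x (le_of_lt hx)).1).mono fun y hy => neg_le_neg hy.le)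
        fun x hx => Eventually.mono (p := fun y => f y < f x) (hT x (le_of_lt hx)).2
          fun y hy => neg_lt_neg hy).elim
    · obtain ⟨T, hT⟩ := eventually_atTop.1 (hA.and hC)
      exact ⟨T, .inr (monotoneOn_Ioi_of_local
        (fun x hx => (hA' x (hT x (le_of_lt hx)).1).mono fun y hy => neg_le_neg hy.le)
        fun x hx => (hC' x (hT x (le_of_lt hx)).2).mono fun y hy => neg_le_neg hy)⟩

theorem frequently_differentiableAt_of_monotoneOn {f : ℝ → ℝ} {T : ℝ}
    (hf : MonotoneOn f (Ioi T)) : ∃ᶠ x in atTop, DifferentiableAt ℝ f x := by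
  rw [frequently_atTop]
  intro S
  by_contra! h
  have hnull : MeasureTheory.volume (Ioi (max S T)) = 0 := by
    refine MeasureTheory.measure_mono_null (fun x hx => ?_) hf.ae_differentiableWithinAt_of_mem
    intro hd
    have hx' := max_lt_iff.1 (Set.mem_Ioi.1 hx)
    exact h x hx'.1.le ((hd hx'.2).differentiableAt (Ioi_mem_nhds hx'.2))
  simp at hnull

theorem eventually_differentiableAt (hE : ExpandsOrderedField L) (hlom : LocallyOMinimal L)
    (htame : ∀ X, Def1 L X → Decides atTop X) {f : ℝ → ℝ}
    (hf : DFun L fun x : Unit → ℝ => f (x ())) : ∀ᶠ x in atTop, DifferentiableAt ℝ f x := by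
  have hfreq : ∃ᶠ x in atTop, DifferentiableAt ℝ f x := by
    obtain ⟨T, hT | hT⟩ := eventually_monotone hE hlom htame hf
    · exact frequently_differentiableAt_of_monotoneOn hT
    · exact (frequently_differentiableAt_of_monotoneOn hT).mono fun x hx => by simpa using hx.neg
  have hdef : Def1 L {x | DifferentiableAt ℝ f x} := by
    refine dpred_unary_iff_def1.1 (DPred.congr (P := fun x : Unit → ℝ =>
      ∃ y, HasDerivAt f y (x ())) ?_ fun x => ?_)
    · exact .exists (.comp_binary (R := fun t y => HasDerivAt f y t) (dpred_hasDerivAt hE hf)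
        (.var _) (.var _))
    · exact ⟨fun h => ⟨_, h.hasDerivAt⟩, fun ⟨y, hy⟩ => hy.differentiableAt⟩
  exact (htame _ hdef).resolve_right fun h => hfreq h

theorem eventually_contDiffOn (hE : ExpandsOrderedField L) (hlom : LocallyOMinimal L)
    (htame : ∀ X, Def1 L X → Decides atTop X) (r : ℕ) {f : ℝ → ℝ}
    (hf : DFun L fun x : Unit → ℝ => f (x ())) : ∃ T, ContDiffOn ℝ r f (Ioi T) := by
  induction r generalizing f with
  | zero =>
    obtain ⟨T, hT⟩ := eventually_atTop.1 (eventually_differentiableAt hE hlom htame hf)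
    refine ⟨T, contDiffOn_zero.2 fun x hx => ?_⟩
    exact (hT x (le_of_lt hx)).continuousAt.continuousWithinAt
  | succ r ih =>
    obtain ⟨T, hT⟩ := eventually_atTop.1 (eventually_differentiableAt hE hlom htame hf)
    obtain ⟨T', hT'⟩ := ih (hf.deriv hE)
    refine ⟨max T T', ?_⟩
    rw [Nat.cast_succ, contDiffOn_succ_iff_deriv_of_isOpen isOpen_Ioi]
    refine ⟨fun x hx => ?_, by simp, hT'.mono (Ioi_subset_Ioi (le_max_right _ _))⟩
    exact (hT x ((le_max_left _ _).trans (le_of_lt hx))).differentiableWithinAt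

end EventualSmoothness

section Majorant

open Filter

variable {L}

theorem hasDerivAt_max_zero_pow (k : ℕ) (u : ℝ) :
    HasDerivAt (fun u : ℝ => max u 0 ^ (k + 2)) ((k + 2) * max u 0 ^ (k + 1)) u := by
  rcases lt_trichotomy u 0 with h | rfl | h
  · rw [max_eq_right h.le]
    have : (fun u : ℝ => max u 0 ^ (k + 2)) =ᶠ[𝓝 u] fun _ => 0 := by
      filter_upwards [Iio_mem_nhds h] with v hv
      simp [max_eq_right (Set.mem_Iio.1 hv).le]
    simpa using (hasDerivAt_const u (0 : ℝ)).congr_of_eventuallyEq this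
  · rw [hasDerivAt_iff_isLittleO_nhds_zero]
    have h1 : (fun h : ℝ => h ^ (k + 2)) =o[𝓝 0] fun h => h := by
      simpa using Asymptotics.isLittleO_pow_pow (𝕜 := ℝ) (m := 1) (n := k + 2) (by omega)
    refine (Asymptotics.IsBigO.of_bound 1 (Eventually.of_forall fun h => ?_)).trans_isLittleO h1
    simp only [zero_add, max_self, ne_eq, Nat.add_eq_zero_iff, OfNat.ofNat_ne_zero, and_false,
      not_false_eq_true, zero_pow, sub_zero, one_ne_zero, mul_zero, smul_zero, norm_pow,
      Real.norm_eq_abs, one_mul]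
    refine pow_le_pow_left₀ (abs_nonneg _) ?_ _
    rw [abs_of_nonneg (le_max_right _ _)]
    exact max_le (le_abs_self h) (abs_nonneg h)
  · rw [max_eq_left h.le]
    have : (fun u : ℝ => max u 0 ^ (k + 2)) =ᶠ[𝓝 u] fun u => u ^ (k + 2) := by
      filter_upwards [Ioi_mem_nhds h] with v hv
      rw [max_eq_left (le_of_lt hv)]
    have h2 := (hasDerivAt_pow (k + 2) u).congr_of_eventuallyEq this
    simpa using h2

theorem contDiff_max_zero_pow (r : ℕ) : ContDiff ℝ r fun u : ℝ => max u 0 ^ (r + 1) := by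
  induction r with
  | zero =>
    refine contDiff_zero.2 ?_
    fun_prop
  | succ r ih =>
    rw [Nat.cast_succ, contDiff_succ_iff_deriv]
    refine ⟨fun u => (hasDerivAt_max_zero_pow r u).differentiableAt, by simp, ?_⟩
    rw [show deriv (fun u : ℝ => max u 0 ^ (r + 1 + 1)) = fun u : ℝ =>
        ((r : ℝ) + 2) * max u 0 ^ (r + 1) from
      funext fun u => (hasDerivAt_max_zero_pow r u).deriv]
    exact contDiff_const.mul ih

/-- A semialgebraic `C^r` step from `0` on `(-∞, 0]` to `1` on `[1, ∞)`. -/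
noncomputable def step (r : ℕ) (u : ℝ) : ℝ :=
  max u 0 ^ (r + 1) * (max u 0 ^ (r + 1) + max (1 - u) 0 ^ (r + 1))⁻¹

theorem step_denom_pos (r : ℕ) (u : ℝ) : 0 < max u 0 ^ (r + 1) + max (1 - u) 0 ^ (r + 1) := by
  rcases lt_or_ge 0 u with h | h
  · have : 0 < max u 0 := lt_max_of_lt_left h
    positivity
  · have : 0 < max (1 - u) 0 := lt_max_of_lt_left (by linarith)
    positivity

theorem contDiff_step (r : ℕ) : ContDiff ℝ r (step r) := by
  have h1 := contDiff_max_zero_pow r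
  have h2 : ContDiff ℝ r fun u : ℝ => max (1 - u) 0 ^ (r + 1) :=
    h1.comp (contDiff_const.sub contDiff_id)
  exact h1.mul ((h1.add h2).inv fun u => (step_denom_pos r u).ne')

theorem step_nonneg (r : ℕ) (u : ℝ) : 0 ≤ step r u :=
  mul_nonneg (by positivity) (inv_nonneg.2 (step_denom_pos r u).le)

theorem step_le_one (r : ℕ) (u : ℝ) : step r u ≤ 1 := by
  rw [step, ← div_eq_mul_inv, div_le_one (step_denom_pos r u)]
  have : 0 ≤ max (1 - u) 0 ^ (r + 1) := by positivity
  linarith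

theorem step_of_nonpos (r : ℕ) {u : ℝ} (hu : u ≤ 0) : step r u = 0 := by
  simp [step, max_eq_right hu]

theorem step_of_one_le (r : ℕ) {u : ℝ} (hu : 1 ≤ u) : step r u = 1 := by
  have h := (step_denom_pos r u).ne'
  have h0 : max (1 - u) 0 = 0 := max_eq_right (by linarith)
  rw [step]
  simp only [h0, ne_eq, Nat.add_eq_zero_iff, one_ne_zero, and_false, not_false_eq_true, zero_pow,
    add_zero] at h ⊢
  exact mul_inv_cancel₀ h

theorem DFun.step (hE : ExpandsOrderedField L) (r : ℕ) {α : Type} {f : (α → ℝ) → ℝ}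
    (hf : DFun L f) : DFun L fun x => step r (f x) := by
  refine DFun.comp_unary (F := Paper.step r) ?_ hf
  exact .mul hE (.pow hE (.max hE (.var _) (.const _)) _) (.inv hE (.add hE
    (.pow hE (.max hE (.var _) (.const _)) _)
    (.pow hE (.max hE (.sub hE (.const _) (.var _)) (.const _)) _)))

theorem Def1.frontier (hE : ExpandsOrderedField L) {X : Set ℝ} (hX : Def1 L X) :
    Def1 L (frontier X) := by
  have hX' := dpred_unary_iff_def1.2 hX
  have hball : ∀ Y : ℝ → Prop, DPred L (fun x : Unit → ℝ => Y (x ())) →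
      DPred L fun x : Unit → ℝ => ∀ δ, 0 < δ → ∃ u, Y u ∧ |x () - u| < δ := fun Y hY =>
    .forall (.imp (.lt hE (.const _) (.var _)) (.exists (.and (.comp_unary hY (.var _))
      (.lt hE (.abs hE (.sub hE (.var _) (.var _))) (.var _)))))
  refine dpred_unary_iff_def1.1
    (((hball _ hX').and (hball (fun u => u ∉ X) hX'.not)).congr fun x => ?_)
  rw [frontier_eq_closure_inter_closure, mem_inter_iff, Metric.mem_closure_iff,
    Metric.mem_closure_iff]
  rfl

theorem eventually_notMem_frontier_right (hlom : LocallyOMinimal L) {X : Set ℝ} (hX : Def1 L X)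
    (t : ℝ) : ∀ᶠ u in 𝓝[>] t, u ∉ frontier X := by
  rcases hlom.decides_right hX t with h | h
  · obtain ⟨d, hd, hd'⟩ := mem_nhdsGT_iff_exists_Ioo_subset.1 h
    filter_upwards [Ioo_mem_nhdsGT hd] with u hu
    exact fun hu' => hu'.2 (interior_maximal hd' isOpen_Ioo hu)
  · obtain ⟨d, hd, hd'⟩ := mem_nhdsGT_iff_exists_Ioo_subset.1 h
    filter_upwards [Ioo_mem_nhdsGT hd] with u hu
    rw [← frontier_compl]
    exact fun hu' => hu'.2 (interior_maximal hd' isOpen_Ioo hu)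

theorem eventually_notMem_frontier_left (hlom : LocallyOMinimal L) {X : Set ℝ} (hX : Def1 L X)
    (t : ℝ) : ∀ᶠ u in 𝓝[<] t, u ∉ frontier X := by
  rcases hlom.decides_left hX t with h | h
  · obtain ⟨d, hd, hd'⟩ := mem_nhdsLT_iff_exists_Ioo_subset.1 h
    filter_upwards [Ioo_mem_nhdsLT hd] with u hu
    exact fun hu' => hu'.2 (interior_maximal hd' isOpen_Ioo hu)
  · obtain ⟨d, hd, hd'⟩ := mem_nhdsLT_iff_exists_Ioo_subset.1 h
    filter_upwards [Ioo_mem_nhdsLT hd] with u hu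
    rw [← frontier_compl]
    exact fun hu' => hu'.2 (interior_maximal hd' isOpen_Ioo hu)

theorem inter_frontier_nonempty_of_isPreconnected {X s : Set ℝ} (hs : IsPreconnected s)
    (h1 : (s ∩ X).Nonempty) (h2 : (s ∩ Xᶜ).Nonempty) : (s ∩ frontier X).Nonempty := by
  by_contra hempty
  have hmem : ∀ x ∈ s, x ∈ interior X ∨ x ∈ interior Xᶜ := fun x hx => by
    by_contra! hcon
    refine hempty ⟨x, hx, ?_, hcon.1⟩
    rw [← compl_compl (closure X), ← interior_compl]
    exact hcon.2
  obtain ⟨x, -, hx1, hx2⟩ := hs _ _ isOpen_interior isOpen_interior hmem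
    (h1.imp fun x hx => ⟨hx.1, (hmem x hx.1).resolve_right fun h => interior_subset h hx.2⟩)
    (h2.imp fun x hx => ⟨hx.1, (hmem x hx.1).resolve_left fun h => hx.2 (interior_subset h)⟩)
  exact interior_subset hx2 (interior_subset hx1)

theorem exists_isLeast_inter_Ioi {D : Set ℝ} (hD : IsClosed D)
    (hdisc : ∀ t, ∀ᶠ u in 𝓝[>] t, u ∉ D) (hunb : ∀ t, (Ioi t ∩ D).Nonempty) (t : ℝ) :
    ∃ s, IsLeast (D ∩ Ioi t) s := by
  obtain ⟨d, hd, hd'⟩ := mem_nhdsGT_iff_exists_Ioo_subset.1 (hdisc t)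
  have heq : D ∩ Ioi t = D ∩ Ici d := by
    ext u
    refine and_congr_right fun hu => ⟨fun h => ?_, fun h => Set.mem_Ioi.2 (lt_of_lt_of_le hd h)⟩
    by_contra hlt
    exact hd' ⟨h, not_le.1 hlt⟩ hu
  rw [heq]
  have hne : (D ∩ Ici d).Nonempty := heq ▸ (hunb t).imp fun x hx => ⟨hx.2, hx.1⟩
  exact ⟨_, (hD.inter isClosed_Ici).isLeast_csInf hne ⟨d, fun x hx => hx.2⟩⟩

theorem exists_isGreatest_inter_Iio {D : Set ℝ} (hD : IsClosed D)
    (hdisc : ∀ t, ∀ᶠ u in 𝓝[<] t, u ∉ D) (hunb : ∀ t, (Iio t ∩ D).Nonempty) (t : ℝ) :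
    ∃ s, IsGreatest (D ∩ Iio t) s := by
  obtain ⟨d, hd, hd'⟩ := mem_nhdsLT_iff_exists_Ioo_subset.1 (hdisc t)
  have heq : D ∩ Iio t = D ∩ Iic d := by
    ext u
    refine and_congr_right fun hu => ⟨fun h => ?_, fun h => Set.mem_Iio.2 (lt_of_le_of_lt h hd)⟩
    by_contra hlt
    exact hd' ⟨not_le.1 hlt, h⟩ hu
  rw [heq]
  have hne : (D ∩ Iic d).Nonempty := heq ▸ (hunb t).imp fun x hx => ⟨hx.2, hx.1⟩
  exact ⟨_, (hD.inter isClosed_Iic).isGreatest_csSup hne ⟨d, fun x hx => hx.2⟩⟩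

/-- A monotone definable function has a definable `C^r` strict majorant, obtained by smooth
interpolation along a discrete definable set which is unbounded in both directions. -/
theorem exists_contDiff_majorant_of_discrete (hE : ExpandsOrderedField L) (r : ℕ) {D : Set ℝ}
    (hDdef : Def1 L D) (hD : IsClosed D) (hdiscR : ∀ t, ∀ᶠ u in 𝓝[>] t, u ∉ D)
    (hdiscL : ∀ t, ∀ᶠ u in 𝓝[<] t, u ∉ D) (hunbR : ∀ t, (Ioi t ∩ D).Nonempty)
    (hunbL : ∀ t, (Iio t ∩ D).Nonempty) {G : ℝ → ℝ}
    (hG : DFun L fun x : Unit → ℝ => G (x ())) (hmono : Monotone G) :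
    ∃ H : ℝ → ℝ, (DFun L fun x : Unit → ℝ => H (x ())) ∧ ContDiff ℝ r H ∧ ∀ t, G t < H t := by
  have hDdef' := dpred_unary_iff_def1.2 hDdef
  choose s hs using exists_isLeast_inter_Ioi hD hdiscR hunbR
  choose p' hp' using exists_isGreatest_inter_Iio hD hdiscL hunbL
  have hp : ∀ t, ∃ a, IsGreatest (D ∩ Iic t) a := fun t =>
    ⟨_, (hD.inter isClosed_Iic).isGreatest_csSup
      ((hunbL t).imp fun x hx => ⟨hx.2, (Set.mem_Iio.1 hx.1).le⟩) ⟨t, fun x hx => hx.2⟩⟩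
  choose p hp using hp
  have hsdef : DFun L fun x : Unit → ℝ => s (x ()) := by
    refine DFun.of_graph_iff (R := fun t y => (y ∈ D ∧ t < y) ∧ ∀ z, z ∈ D → t < z → y ≤ z)
      (fun t y => ⟨?_, fun h => ?_⟩) ?_
    · rintro rfl
      exact ⟨(hs t).1, fun z hz hz' => (hs t).2 ⟨hz, hz'⟩⟩
    · exact IsLeast.unique ⟨h.1, fun z hz => h.2 z hz.1 hz.2⟩ (hs t)
    · exact .and (.and (.comp_unary hDdef' (.var _)) (.lt hE (.var _) (.var _))) (.forall (.imp
        (.comp_unary hDdef' (.var _)) (.imp (.lt hE (.var _) (.var _)) (.le hE (.var _) (.var _)))))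
  have hpdef : DFun L fun x : Unit → ℝ => p (x ()) := by
    refine DFun.of_graph_iff (R := fun t y => (y ∈ D ∧ y ≤ t) ∧ ∀ z, z ∈ D → z ≤ t → z ≤ y)
      (fun t y => ⟨?_, fun h => ?_⟩) ?_
    · rintro rfl
      exact ⟨(hp t).1, fun z hz hz' => (hp t).2 ⟨hz, hz'⟩⟩
    · exact IsGreatest.unique ⟨h.1, fun z hz => h.2 z hz.1 hz.2⟩ (hp t)
    · exact .and (.and (.comp_unary hDdef' (.var _)) (.le hE (.var _) (.var _))) (.forall (.imp
        (.comp_unary hDdef' (.var _)) (.imp (.le hE (.var _) (.var _)) (.le hE (.var _) (.var _)))))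
  have hpt : ∀ t, p t ≤ t := fun t => (hp t).1.2
  have hst : ∀ t, t < s t := fun t => (hs t).1.2
  have hsp : ∀ t, t < s (p t) := fun t => by
    by_contra h
    exact absurd ((hp t).2 ⟨(hs (p t)).1.1, not_lt.1 h⟩) (not_le.2 (hst _))
  have hps : ∀ t a b, a ∈ D → b ∈ D → (∀ u ∈ D, a < u → b ≤ u) → a ≤ t → t < b →
      p t = a ∧ s t = b := fun t a b ha hb hab hat htb => by
    refine ⟨(hp t).unique ⟨⟨ha, hat⟩, fun u hu => ?_⟩,
      (hs t).unique ⟨⟨hb, htb⟩, fun u hu => hab u hu.1 (lt_of_le_of_lt hat hu.2)⟩⟩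
    by_contra h
    exact absurd (hab u hu.1 (not_le.1 h)) (not_le.2 (lt_of_le_of_lt hu.2 htb))
  set c : ℝ → ℝ := fun t => G (s t) + 1 with hc
  have hcdef : DFun L fun x : Unit → ℝ => c (x ()) := .add hE (.comp_unary hG hsdef) (.const _)
  have hpiece : ∀ a b : ℝ, ContDiff ℝ r fun t : ℝ => step r ((t - a) * (b - a)⁻¹) := fun a b =>
    (contDiff_step r).comp ((contDiff_id.sub contDiff_const).mul contDiff_const)
  refine ⟨fun t => c (p t) + (c (s t) - c (p t)) * step r ((t - p t) * (s t - p t)⁻¹),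
    ?_, ?_, fun t => ?_⟩
  · exact .add hE (.comp_unary hcdef hpdef) (.mul hE
      (.sub hE (.comp_unary hcdef hsdef) (.comp_unary hcdef hpdef)) (.step hE r
        (.mul hE (.sub hE (.var _) hpdef) (.inv hE (.sub hE hsdef hpdef)))))
  · rw [contDiff_iff_contDiffAt]
    intro t₀
    have ha := hp' t₀
    have hb := hs t₀
    set a := p' t₀
    set b := s t₀
    have hat : a < t₀ := ha.1.2
    have htb : t₀ < b := hb.1.2
    by_cases ht₀ : t₀ ∈ D
    · have hsmooth : ContDiff ℝ r fun t : ℝ => c a +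
          (c t₀ - c a) * step r ((t - a) * (t₀ - a)⁻¹) +
          (c b - c t₀) * step r ((t - t₀) * (b - t₀)⁻¹) :=
        (contDiff_const.add (contDiff_const.mul (hpiece _ _))).add
          (contDiff_const.mul (hpiece _ _))
      refine hsmooth.contDiffAt.congr_of_eventuallyEq ?_
      filter_upwards [Ioo_mem_nhds hat htb] with t ht
      have hat' : 0 < t₀ - a := sub_pos.2 hat
      have htb' : 0 < b - t₀ := sub_pos.2 htb
      rcases lt_or_ge t t₀ with h | h
      · obtain ⟨h1, h2⟩ := hps t a t₀ ha.1.1 ht₀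
          (fun u hu hau => le_of_not_gt fun h => absurd (ha.2 ⟨hu, h⟩) (not_le.2 hau)) ht.1.le h
        rw [h1, h2, step_of_nonpos r (u := (t - t₀) * (b - t₀)⁻¹)]
        · ring
        · exact mul_nonpos_of_nonpos_of_nonneg (by linarith) (inv_nonneg.2 htb'.le)
      · obtain ⟨h1, h2⟩ := hps t t₀ b ht₀ hb.1.1 (fun u hu hau => hb.2 ⟨hu, hau⟩) h ht.2
        rw [h1, h2, step_of_one_le r (u := (t - a) * (t₀ - a)⁻¹)]
        · ring
        · rw [← div_eq_mul_inv, one_le_div hat']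
          linarith
    · have hsmooth : ContDiff ℝ r fun t : ℝ => c a +
          (c b - c a) * step r ((t - a) * (b - a)⁻¹) :=
        contDiff_const.add (contDiff_const.mul (hpiece _ _))
      refine hsmooth.contDiffAt.congr_of_eventuallyEq ?_
      filter_upwards [Ioo_mem_nhds hat htb] with t ht
      obtain ⟨h1, h2⟩ := hps t a b ha.1.1 hb.1.1 (fun u hu hau => by
        rcases lt_trichotomy u t₀ with h | h | h
        · exact absurd (ha.2 ⟨hu, h⟩) (not_le.2 hau)
        · exact absurd (h ▸ hu) ht₀
        · exact hb.2 ⟨hu, h⟩) ht.1.le ht.2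
      rw [h1, h2]
  · have h1 : G t + 1 ≤ c (p t) := add_le_add_left (hmono (hsp t).le) 1
    have h2 : G t + 1 ≤ c (s t) := add_le_add_left (hmono ((hst t).trans (hst _)).le) 1
    have h3 := step_nonneg r ((t - p t) * (s t - p t)⁻¹)
    have h4 := step_le_one r ((t - p t) * (s t - p t)⁻¹)
    show G t < _
    nlinarith [mul_nonneg h3 (sub_nonneg.2 h2), mul_nonneg (sub_nonneg.2 h4) (sub_nonneg.2 h1)]

/-- A positive monotone definable function which is eventually `C^r` has a definable `C^r` strict
majorant. -/
theorem exists_contDiff_majorant_of_contDiffOn (hE : ExpandsOrderedField L) (r : ℕ) {G : ℝ → ℝ}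
    (hG : DFun L fun x : Unit → ℝ => G (x ())) (hmono : Monotone G) (hpos : ∀ t, 0 < G t)
    {T : ℝ} (hT : ContDiffOn ℝ r G (Ioi T)) :
    ∃ H : ℝ → ℝ, (DFun L fun x : Unit → ℝ => H (x ())) ∧ ContDiff ℝ r H ∧ ∀ t, G t < H t := by
  refine ⟨fun t => (G (T + 2) + 1) + max (t - (T + 1)) 0 ^ (r + 1) * G t, ?_, ?_, fun t => ?_⟩
  · exact .add hE (.const _) (.mul hE
      (.pow hE (.max hE (.sub hE (.var _) (.const _)) (.const _)) _) hG)
  · rw [contDiff_iff_contDiffAt]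
    intro t
    rcases lt_or_ge T t with h | h
    · refine contDiffAt_const.add (ContDiffAt.mul ?_ (hT.contDiffAt (Ioi_mem_nhds h)))
      exact ((contDiff_max_zero_pow r).comp (contDiff_id.sub contDiff_const)).contDiffAt
    · refine (contDiffAt_const (c := G (T + 2) + 1)).congr_of_eventuallyEq ?_
      filter_upwards [Iio_mem_nhds (show t < T + 1 by linarith)] with u hu
      simp [max_eq_right (sub_nonpos.2 (Set.mem_Iio.1 hu).le)]
  · show G t < _
    rcases le_or_gt t (T + 2) with h | h
    · have h1 := hmono h
      have h2 : 0 ≤ max (t - (T + 1)) 0 ^ (r + 1) * G t := mul_nonneg (by positivity) (hpos t).le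
      linarith
    · have h1 : 1 ≤ max (t - (T + 1)) 0 ^ (r + 1) :=
        one_le_pow₀ (le_max_of_le_left (by linarith))
      have h2 := le_mul_of_one_le_left (hpos t).le h1
      have h3 := hpos (T + 2)
      linarith

theorem exists_contDiff_majorant (hE : ExpandsOrderedField L) (hlom : LocallyOMinimal L) (r : ℕ)
    {G : ℝ → ℝ} (hG : DFun L fun x : Unit → ℝ => G (x ())) (hmono : Monotone G)
    (hpos : ∀ t, 0 < G t) :
    ∃ H : ℝ → ℝ, (DFun L fun x : Unit → ℝ => H (x ())) ∧ ContDiff ℝ r H ∧ ∀ t, G t < H t := by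
  by_cases htame : ∀ X, Def1 L X → Decides atTop X
  · obtain ⟨T, hT⟩ := eventually_contDiffOn hE hlom htame r hG
    exact exists_contDiff_majorant_of_contDiffOn hE r hG hmono hpos hT
  push Not at htame
  obtain ⟨X, hX, hXdec⟩ := htame
  have hX' : Def1 L {t | |t| ∈ X} :=
    dpred_unary_iff_def1.1 (DPred.comp_unary (X := fun u => u ∈ X) (dpred_unary_iff_def1.2 hX)
      (.abs hE (.var _)))
  have hin : ∀ t, ∃ u ≥ t, u ∈ X := frequently_atTop.1 fun h => hXdec (.inr h)
  have hout : ∀ t, ∃ u ≥ t, u ∉ X :=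
    frequently_atTop.1 fun h => hXdec (.inl (h.mono fun x hx => not_not.1 hx))
  refine exists_contDiff_majorant_of_discrete hE r (hX'.frontier hE) isClosed_frontier
    (eventually_notMem_frontier_right hlom hX') (eventually_notMem_frontier_left hlom hX')
    (fun t => ?_) (fun t => ?_) hG hmono
  · obtain ⟨u, hu, huX⟩ := hin (|t| + 1)
    obtain ⟨v, hv, hvX⟩ := hout (|t| + 1)
    have h := abs_nonneg t
    have h' := le_abs_self t
    refine inter_frontier_nonempty_of_isPreconnected isPreconnected_Ioi
      ⟨u, show t < u by linarith, ?_⟩ ⟨v, show t < v by linarith, ?_⟩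
    · rwa [mem_ofPred_eq, abs_of_nonneg (by linarith)]
    · rwa [mem_compl_iff, mem_ofPred_eq, abs_of_nonneg (by linarith)]
  · obtain ⟨u, hu, huX⟩ := hin (|t| + 1)
    obtain ⟨v, hv, hvX⟩ := hout (|t| + 1)
    have h := abs_nonneg t
    have h' := neg_abs_le t
    refine inter_frontier_nonempty_of_isPreconnected isPreconnected_Iio
      ⟨-u, show -u < t by linarith, ?_⟩ ⟨-v, show -v < t by linarith, ?_⟩
    · rwa [mem_ofPred_eq, abs_neg, abs_of_nonneg (by linarith)]
    · rwa [mem_compl_iff, mem_ofPred_eq, abs_neg, abs_of_nonneg (by linarith)]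

end Majorant

section Reduction

variable {L}

theorem defFunOn_of_dfun {n : ℕ} {M : Set (Fin n → ℝ)} (hM : Def L n M) {f : (Fin n → ℝ) → ℝ}
    (hf : DFun L f) : DefFunOn L n M f := by
  have hM' : DPred L fun x => x ∈ M := hM
  have h : DPred L fun z : Fin (n + 1) → ℝ => fstFun z ∈ M ∧ z (Fin.natAdd n 0) = f (fstFun z) :=
    (hM'.subst (F := fun i z => z (Fin.castAdd 1 i)) fun _ => .var _).and
      (.eq (.var _) (hf.subst (F := fun i z => z (Fin.castAdd 1 i)) fun _ => .var _))
  exact h.congr fun z => and_congr_right fun _ =>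
    ⟨fun h => congrFun h 0, fun h => funext fun j => by rw [Subsingleton.elim j 0]; exact h⟩

theorem exists_pos_le_of_isCompact {E : Type*} [TopologicalSpace E] {K : Set E} (hK : IsCompact K)
    {ψ : E → ℝ} (hψ : ∀ x ∈ K, ∃ W : Set E, IsOpen W ∧ x ∈ W ∧
      ∃ c : ℝ, 0 < c ∧ ∀ y ∈ K ∩ W, c ≤ ψ y) : ∃ c : ℝ, 0 < c ∧ ∀ y ∈ K, c ≤ ψ y := by
  refine hK.induction_on (p := fun S => ∃ c : ℝ, 0 < c ∧ ∀ y ∈ S, c ≤ ψ y) ⟨1, one_pos, by simp⟩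
    (fun S S' hS ⟨c, hc, h⟩ => ⟨c, hc, fun y hy => h y (hS hy)⟩) ?_ fun x hx => ?_
  · rintro S S' ⟨c, hc, h⟩ ⟨c', hc', h'⟩
    refine ⟨min c c', lt_min hc hc', ?_⟩
    rintro y (hy | hy)
    · exact (min_le_left _ _).trans (h y hy)
    · exact (min_le_right _ _).trans (h' y hy)
  · obtain ⟨W, hW, hxW, hc⟩ := hψ x hx
    exact ⟨K ∩ W, inter_mem_nhdsWithin K (hW.mem_nhds hxW), hc⟩

theorem isCompact_inter_sum_sq_le {n : ℕ} {M : Set (Fin n → ℝ)} (hM : IsClosed M) (t : ℝ) :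
    IsCompact (M ∩ {x | ∑ i, x i ^ 2 ≤ t}) := by
  refine (isCompact_univ_pi fun _ : Fin n => isCompact_Icc (a := -(|t| + 1)) (b := |t| + 1))
    |>.of_isClosed_subset (hM.inter (isClosed_le (by fun_prop) continuous_const)) ?_
  intro x hx i _
  have h1 : x i ^ 2 ≤ t :=
    (Finset.single_le_sum (f := fun i => x i ^ 2) (fun i _ => sq_nonneg _)
      (Finset.mem_univ i)).trans hx.2
  exact abs_le.1 (abs_le_of_sq_le_sq (by nlinarith [le_abs_self t, abs_nonneg t]) (by positivity))

/-- The reciprocal of a definable function on a closed set which is locally bounded below by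
positive constants is dominated by a monotone definable function of the squared norm. -/
theorem exists_monotone_bound (hE : ExpandsOrderedField L) {n : ℕ} {M : Set (Fin n → ℝ)}
    (hMclosed : IsClosed M) {ψ : (Fin n → ℝ) → ℝ} (hψdef : DefFunOn L n M ψ)
    (hψlb : ∀ x ∈ M, ∃ W : Set (Fin n → ℝ), IsOpen W ∧ x ∈ W ∧
      ∃ c : ℝ, 0 < c ∧ ∀ y ∈ M ∩ W, c ≤ ψ y) :
    ∃ G : ℝ → ℝ, (DFun L fun x : Unit → ℝ => G (x ())) ∧ Monotone G ∧ (∀ t, 0 < G t) ∧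
      ∀ x ∈ M, (ψ x)⁻¹ ≤ G (∑ i, x i ^ 2) := by
  set A : ℝ → Set ℝ := fun t => {y | 1 ≤ y ∧ ∀ x ∈ M, ∑ i, x i ^ 2 ≤ t → (ψ x)⁻¹ ≤ y} with hA
  have hne : ∀ t, (A t).Nonempty := fun t => by
    obtain ⟨c, hc, h⟩ := exists_pos_le_of_isCompact (ψ := ψ) (isCompact_inter_sum_sq_le hMclosed t)
      fun x hx => by
        obtain ⟨W, hW, hxW, c, hc, h⟩ := hψlb x hx.1
        exact ⟨W, hW, hxW, c, hc, fun y hy => h y ⟨hy.1.1, hy.2⟩⟩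
    refine ⟨max 1 c⁻¹, le_max_left _ _, fun x hx hxt => (le_max_right _ _).trans' ?_⟩
    exact inv_anti₀ hc (h x ⟨hx, hxt⟩)
  have hbdd : ∀ t, BddBelow (A t) := fun t => ⟨1, fun y hy => hy.1⟩
  have hψ : DPred L fun z : Fin (n + 1) → ℝ => fstFun z ∈ M ∧ sndFun z = fun _ => ψ (fstFun z) :=
    hψdef
  have hAdef : DPred L fun z : Fin 2 → ℝ => z 1 ∈ A (z 0) := by
    have hbad : DPred L fun z : Fin 2 → ℝ => ∃ x : Fin n → ℝ, ∃ w : ℝ,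
        (x ∈ M ∧ w = ψ x) ∧ ∑ i, x i ^ 2 ≤ z 0 ∧ z 1 < w⁻¹ := by
      refine .exists_fun (.exists (.and ?_ (.and (.le hE (.sum hE _ fun i => .pow hE (.var _) _)
        (.var _)) (.lt hE (.var _) (.inv hE (.var _))))))
      refine (hψ.subst (F := Fin.append (fun i (z : (Fin 2 ⊕ Fin n) ⊕ Unit → ℝ) =>
        z (Sum.inl (Sum.inr i))) (fun _ z => z (Sum.inr ()))) fun b => ?_).congr fun z => ?_
      · refine Fin.addCases (fun i => ?_) (fun i => ?_) b
        · rw [Fin.append_left]; exact .var _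
        · rw [Fin.append_right]; exact .var _
      · have h1 : fstFun (m := n) (n := 1) (fun b => Fin.append
            (fun i (z : (Fin 2 ⊕ Fin n) ⊕ Unit → ℝ) => z (Sum.inl (Sum.inr i)))
            (fun _ z => z (Sum.inr ())) b z) = fun i => z (Sum.inl (Sum.inr i)) := by
          funext i; simp [fstFun]
        have h2 : sndFun (m := n) (n := 1) (fun b => Fin.append
            (fun i (z : (Fin 2 ⊕ Fin n) ⊕ Unit → ℝ) => z (Sum.inl (Sum.inr i)))
            (fun _ z => z (Sum.inr ())) b z) = fun _ => z (Sum.inr ()) := by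
          funext i; simp [sndFun]
        rw [h1, h2, funext_iff]
        simp
    refine (DPred.and (.le hE (.const 1) (.var 1)) hbad.not).congr fun z => ?_
    refine and_congr_right fun _ => ⟨?_, fun h x hx hxt => ?_⟩
    · rintro h ⟨x, w, ⟨hx, rfl⟩, hxt, hlt⟩
      exact absurd (h x hx hxt) (not_le.2 hlt)
    · by_contra hlt
      exact h ⟨x, _, ⟨hx, rfl⟩, hxt, not_le.1 hlt⟩
  refine ⟨fun t => sInf (A t), ?_, fun t t' htt => ?_, fun t => ?_, fun x hx => ?_⟩
  · refine DFun.of_graph_iff (f := fun t => sInf (A t)) (R := fun t y => (∀ z, z ∈ A t → y ≤ z) ∧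
      ∀ w, (∀ z, z ∈ A t → w ≤ z) → w ≤ y) (fun t y => ⟨?_, fun h => ?_⟩) ?_
    · rintro rfl
      exact isGLB_csInf (hne t) (hbdd t)
    · exact IsGLB.unique (s := A t) h (isGLB_csInf (hne t) (hbdd t))
    · have hmem : ∀ {α : Type} {f g : (α → ℝ) → ℝ}, DFun L f → DFun L g →
          DPred L fun z => g z ∈ A (f z) := fun hf hg =>
        .comp_binary (R := fun t y => y ∈ A t) hAdef hf hg
      exact .and (.forall (.imp (hmem (.var _) (.var _)) (.le hE (.var _) (.var _))))
        (.forall (.imp (.forall (.imp (hmem (.var _) (.var _)) (.le hE (.var _) (.var _))))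
          (.le hE (.var _) (.var _))))
  · exact csInf_le_csInf (hbdd t) (hne t') fun y hy =>
      ⟨hy.1, fun x hx hxt => hy.2 x hx (hxt.trans htt)⟩
  · exact one_pos.trans_le (le_csInf (hne t) fun y hy => hy.1)
  · exact le_csInf (hne _) fun y hy => hy.2 x hx le_rfl

end Reduction

/-- a positive definable function on a closed definable `C^r` submanifold
which is locally bounded below by positive constants dominates a positive definable `C^r`
function. -/
theorem statement12
    (hfield : ExpandsOrderedField L) (hlom : LocallyOMinimal L)
    (r n d : ℕ) (M : Set (Fin n → ℝ)) (hM : IsDefCrSubmanifold L r n d M)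
    (hMclosed : IsClosed M)
    (ψ : (Fin n → ℝ) → ℝ) (hψdef : DefFunOn L n M ψ) (hψpos : ∀ x ∈ M, 0 < ψ x)
    (hψlb : ∀ x ∈ M, ∃ W : Set (Fin n → ℝ), IsOpen W ∧ x ∈ W ∧
      ∃ c : ℝ, 0 < c ∧ ∀ y ∈ M ∩ W, c ≤ ψ y) :
    ∃ ε : (Fin n → ℝ) → ℝ, DefCrFunOn L r n M ε ∧
      ∀ x ∈ M, 0 < ε x ∧ ε x < ψ x := by
  obtain ⟨hMdef, -⟩ := hM
  set N : (Fin n → ℝ) → ℝ := fun x => ∑ i, x i ^ 2 with hN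
  have hNdef : DFun L N := .sum hfield _ fun i => .pow hfield (.var i) 2
  obtain ⟨G, hGdef, hGmono, hGpos, hG⟩ := exists_monotone_bound hfield hMclosed hψdef hψlb
  obtain ⟨H, hHdef, hHsmooth, hGH⟩ := exists_contDiff_majorant hfield hlom r hGdef hGmono hGpos
  have hHpos : ∀ t, 0 < H t := fun t => (hGpos t).trans (hGH t)
  refine ⟨fun x => (H (N x))⁻¹, ⟨?_, fun a _ => ?_⟩, fun x hx => ⟨inv_pos.2 (hHpos _), ?_⟩⟩
  · exact defFunOn_of_dfun hMdef (.inv hfield (.comp_unary hHdef hNdef))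
  · refine ⟨univ, fun x => (H (N x))⁻¹, mem_univ _, isOpen_univ, ?_, fun _ _ => rfl⟩
    have hNsmooth : ContDiff ℝ r N := by fun_prop
    exact ((hHsmooth.comp hNsmooth).inv fun x => (hHpos _).ne').contDiffOn
  · exact inv_lt_of_inv_lt₀ (hψpos x hx) ((hG x hx).trans_lt (hGH _))

end Paper
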